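/- arXiv:1612.05182 — 2 statements merged into one kernel-verified Lean document; each statement's English description precedes it below -/
import Mathlib

section
/- The dimension over 𝕜 of the space of linear maps T : W_k → W_ℓ commuting with the Perm (Fin n)-actions (T(σ • g) = σ • T(g) for all σ and g) equals the number of set partitions of a set with k + ℓ elements into at most n blocks (i.e. the cardinality of the set of set partitions of Fin (k+ℓ) having at most n blocks, which is Σ_{p=0}^{n} S(k+ℓ, p) in terms of Stirling numbers of the second kind). -/
open scoped Classical

noncomputable section

namespace Jellyfish

variable {𝕜 : Type*} [Field 𝕜]

/-- The indicator (delta) function `δ_i` of a tuple `i`, a basis vector of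
`W = (ι → Fin n) → 𝕜`. -/
def delta {ι : Type*} {n : ℕ} (i : ι → Fin n) : (ι → Fin n) → 𝕜 :=
  fun j => if j = i then 1 else 0

/-- The linear action of `Equiv.Perm (Fin n)` on `(ι → Fin n) → 𝕜`; it satisfies
`permAct σ (delta i) = delta (σ ∘ i)`. -/
def permAct {ι : Type*} {n : ℕ} (σ : Equiv.Perm (Fin n)) (g : (ι → Fin n) → 𝕜) :
    (ι → Fin n) → 𝕜 :=
  fun j => g (⇑σ.symm ∘ j)

/-- `DET i`: the determinant of the `n × n` matrix whose `b`-th column is the standard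
basis vector `e_{i b}`; entry `(a,b)` is `1` if `i b = a` and `0` otherwise. -/
def DET {n : ℕ} (i : Fin n → Fin n) : 𝕜 :=
  Matrix.det (Matrix.of fun a b => if i b = a then (1 : 𝕜) else 0)

/-- `a` and `b` lie in a common block of the set partition `P`. -/
def sameBlock {ι : Type*} [DecidableEq ι] [Fintype ι]
    (P : Finpartition (Finset.univ : Finset ι)) (a b : ι) : Prop :=
  ∃ B ∈ P.parts, a ∈ B ∧ b ∈ B

/-- The tuple `i` is constant on every block of the set partition `P`. -/
def constOnBlocks {ι : Type*} [DecidableEq ι] [Fintype ι] {n : ℕ}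
    (P : Finpartition (Finset.univ : Finset ι)) (i : ι → Fin n) : Prop :=
  ∀ a b : ι, sameBlock P a b → i a = i b

/-- The kernel (partition into fibers) of the map `p` equals the set partition `P`. -/
def kernelEq {ι : Type*} [DecidableEq ι] [Fintype ι] {m : ℕ}
    (p : ι → Fin m) (P : Finpartition (Finset.univ : Finset ι)) : Prop :=
  ∀ a b : ι, p a = p b ↔ sameBlock P a b

/-- The linear functional `Φ_P` with `Φ_P (δ_i) = 1` if `i` is constant on every
block of `P`, and `0` otherwise. -/
def PhiP {k n : ℕ} (P : Finpartition (Finset.univ : Finset (Fin k))) :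
    ((Fin k → Fin n) → 𝕜) →ₗ[𝕜] 𝕜 :=
  ∑ i : Fin k → Fin n,
    (if constOnBlocks P i then (1 : 𝕜) else 0) •
      (LinearMap.proj i : ((Fin k → Fin n) → 𝕜) →ₗ[𝕜] 𝕜)

/-- The linear functional `f_P` with `f_P (δ_i) = 1` if the kernel of `i` equals `P`,
and `0` otherwise. -/
def fP {k n : ℕ} (P : Finpartition (Finset.univ : Finset (Fin k))) :
    ((Fin k → Fin n) → 𝕜) →ₗ[𝕜] 𝕜 :=
  ∑ i : Fin k → Fin n,
    (if kernelEq i P then (1 : 𝕜) else 0) •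
      (LinearMap.proj i : ((Fin k → Fin n) → 𝕜) →ₗ[𝕜] 𝕜)

/-- The jellyfish functional `J_{p,r}`: `J_{p,r} (δ_i) = DET (i ∘ r)` if `i` is constant
on every fiber of `p`, and `0` otherwise. -/
def Jf {k n : ℕ} (p : Fin k → Fin n) (r : Fin n → Fin k) :
    ((Fin k → Fin n) → 𝕜) →ₗ[𝕜] 𝕜 :=
  ∑ i : Fin k → Fin n,
    (if ∀ a b : Fin k, p a = p b → i a = i b then DET (i ∘ r) else (0 : 𝕜)) •
      (LinearMap.proj i : ((Fin k → Fin n) → 𝕜) →ₗ[𝕜] 𝕜)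

/-- The `n × n` matrix `M(i)` whose column `c`, for `c : Fin (n-1)` embedded as the first
`n-1` columns, is the standard basis vector `e_{i (r c)}`, and whose last column is the
all-ones vector. -/
def Mmat {k n : ℕ} (r : Fin (n - 1) → Fin k) (i : Fin k → Fin n) :
    Matrix (Fin n) (Fin n) 𝕜 :=
  Matrix.of fun a b =>
    if h : (b : ℕ) < n - 1 then (if i (r ⟨(b : ℕ), h⟩) = a then 1 else 0) else 1

/-- The jellyfish functional `J'_{p,r}` (one dangling leg): `J'_{p,r} (δ_i) = det M(i)`
if `i` is constant on every fiber of `p`, and `0` otherwise. -/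
def Jf' {k n : ℕ} (p : Fin k → Fin (n - 1)) (r : Fin (n - 1) → Fin k) :
    ((Fin k → Fin n) → 𝕜) →ₗ[𝕜] 𝕜 :=
  ∑ i : Fin k → Fin n,
    (if ∀ a b : Fin k, p a = p b → i a = i b then (Mmat r i).det else (0 : 𝕜)) •
      (LinearMap.proj i : ((Fin k → Fin n) → 𝕜) →ₗ[𝕜] 𝕜)

/-- The linear map `T_P : W_k → W_ℓ` with `(T_P δ_i) (i') = 1` if `Sum.elim i i'` is
constant on every block of `P`, and `0` otherwise. -/
def TP {k l n : ℕ} (P : Finpartition (Finset.univ : Finset (Fin k ⊕ Fin l))) :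
    ((Fin k → Fin n) → 𝕜) →ₗ[𝕜] ((Fin l → Fin n) → 𝕜) :=
  ∑ i : Fin k → Fin n, ∑ i' : Fin l → Fin n,
    (if constOnBlocks P (Sum.elim i i') then (1 : 𝕜) else 0) •
      ((LinearMap.single 𝕜 (fun _ : Fin l → Fin n => 𝕜) i').comp
        (LinearMap.proj i : ((Fin k → Fin n) → 𝕜) →ₗ[𝕜] 𝕜))

/-- The subspace of linear functionals on `(ι → Fin n) → 𝕜` invariant under all
permutations in `S`. -/
def invariantDual (𝕜 : Type*) [Field 𝕜] (ι : Type*) {n : ℕ}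
    (S : Set (Equiv.Perm (Fin n))) :
    Submodule 𝕜 (((ι → Fin n) → 𝕜) →ₗ[𝕜] 𝕜) where
  carrier := {φ | ∀ σ ∈ S, ∀ g : (ι → Fin n) → 𝕜, φ (permAct σ g) = φ g}
  add_mem' := by
    intro φ ψ hφ hψ σ hσ g
    simp only [LinearMap.add_apply, hφ σ hσ g, hψ σ hσ g]
  zero_mem' := by intro σ hσ g; simp
  smul_mem' := by
    intro c φ hφ σ hσ g
    simp only [LinearMap.smul_apply, hφ σ hσ g]

/-- The subspace of linear maps `W_k → W_ℓ` commuting with the actions of all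
permutations in `S`. -/
def equivariantMaps (𝕜 : Type*) [Field 𝕜] (k l : ℕ) {n : ℕ}
    (S : Set (Equiv.Perm (Fin n))) :
    Submodule 𝕜 (((Fin k → Fin n) → 𝕜) →ₗ[𝕜] ((Fin l → Fin n) → 𝕜)) where
  carrier := {T | ∀ σ ∈ S, ∀ g : (Fin k → Fin n) → 𝕜, T (permAct σ g) = permAct σ (T g)}
  add_mem' := by
    intro T T' hT hT' σ hσ g
    funext j
    simp [LinearMap.add_apply, hT σ hσ g, hT' σ hσ g, permAct]
  zero_mem' := by intro σ hσ g; funext j; simp [permAct]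
  smul_mem' := by
    intro c T hT σ hσ g
    funext j
    simp [LinearMap.smul_apply, hT σ hσ g, permAct]

end Jellyfish

open Jellyfish

/-- A partition is determined by the map sending each point to its block. -/
theorem finpartition_ext_part {α : Type*} [DecidableEq α] {s : Finset α}
    {P Q : Finpartition s} (h : ∀ a, P.part a = Q.part a) : P = Q := by
  have parts_eq_image (R : Finpartition s) : R.parts = s.image R.part := by
    ext B
    rw [Finset.mem_image]
    constructor
    · intro hB
      obtain ⟨a, ha⟩ := R.nonempty_of_mem_parts hB
      exact ⟨a, R.le hB ha, R.part_eq_of_mem hB ha⟩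
    · rintro ⟨a, ha, rfl⟩
      exact R.part_mem.2 ha
  apply Finpartition.ext
  rw [parts_eq_image P, parts_eq_image Q, funext h]

/-- The partition of the index set into the fibers of a tuple with values in `Fin n`. -/
def fiberPartition {ι : Type*} [Fintype ι] [DecidableEq ι] {n : ℕ} (t : ι → Fin n) :
    {P : Finpartition (Finset.univ : Finset ι) // P.parts.card ≤ n} where
  val := Finpartition.ofSetoid (Setoid.ker t)
  property := by
    set P := Finpartition.ofSetoid (Setoid.ker t) with hP
    have hsub : P.parts ⊆ Finset.univ.image fun x => Finset.univ.filter fun a => x = t a := by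
      intro B hB
      obtain ⟨a, ha⟩ := P.nonempty_of_mem_parts hB
      refine Finset.mem_image.2 ⟨t a, Finset.mem_univ _, ?_⟩
      rw [← P.part_eq_of_mem hB ha]
      ext b
      rw [hP, Finpartition.mem_part_ofSetoid_iff_rel]
      simp [Setoid.ker_def]
    simpa using (Finset.card_le_card hsub).trans Finset.card_image_le

theorem mem_part_fiberPartition {ι : Type*} [Fintype ι] [DecidableEq ι] {n : ℕ}
    (t : ι → Fin n) (a b : ι) : b ∈ (fiberPartition t).1.part a ↔ t a = t b := by
  rw [fiberPartition, Finpartition.mem_part_ofSetoid_iff_rel, Setoid.ker_def]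

theorem fiberPartition_surjective {ι : Type*} [Fintype ι] [DecidableEq ι] {n : ℕ} :
    Function.Surjective (fiberPartition (ι := ι) (n := n)) := by
  rintro ⟨P, hP⟩
  obtain ⟨f⟩ : Nonempty (P.parts ↪ Fin n) :=
    Function.Embedding.nonempty_of_card_le (by simpa using hP)
  refine ⟨fun a => f ⟨P.part a, P.part_mem.2 (Finset.mem_univ a)⟩, ?_⟩
  refine Subtype.ext (finpartition_ext_part fun a => ?_)
  ext b
  rw [mem_part_fiberPartition, f.injective.eq_iff, Subtype.mk.injEq,
    P.mem_part_iff_part_eq_part (Finset.mem_univ b) (Finset.mem_univ a)]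
  exact eq_comm

theorem fiberPartition_perm_comp {ι : Type*} [Fintype ι] [DecidableEq ι] {n : ℕ}
    (σ : Equiv.Perm (Fin n)) (t : ι → Fin n) : fiberPartition (σ ∘ t) = fiberPartition t := by
  refine Subtype.ext (finpartition_ext_part fun a => ?_)
  ext b
  simp [mem_part_fiberPartition]

/-- Tuples with the same fibers lie in the same orbit under permutation of the values. -/
theorem exists_perm_comp_eq_of_fiberPartition_eq {ι : Type*} [Fintype ι] [DecidableEq ι] {n : ℕ}
    {t u : ι → Fin n} (h : fiberPartition t = fiberPartition u) :
    ∃ σ : Equiv.Perm (Fin n), σ ∘ t = u := by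
  have hker (a b : ι) : t a = t b ↔ u a = u b := by
    rw [← mem_part_fiberPartition, h, mem_part_fiberPartition]
  let r (x : Set.range t) : ι := x.2.choose
  have hr (x : Set.range t) : t (r x) = x := x.2.choose_spec
  obtain ⟨σ, hσ⟩ := Equiv.Perm.exists_extending_pair (fun x : Set.range t => (x : Fin n))
    (fun x => u (r x)) Subtype.val_injective fun x y hxy =>
      Subtype.ext <| by rw [← hr x, ← hr y]; exact (hker _ _).2 hxy
  refine ⟨σ, funext fun a => ?_⟩
  have hra : u (r ⟨t a, a, rfl⟩) = u a := (hker _ _).1 (hr _)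
  exact (hσ ⟨t a, a, rfl⟩).trans hra

/-- The linear map whose matrix entry at `(j, i)` is the value of `c` on the fiber partition of
the concatenated tuple. -/
def mapOfFiberWeights (𝕜 : Type*) [Field 𝕜] (k l n : ℕ) :
    ({P : Finpartition (Finset.univ : Finset (Fin (k + l))) // P.parts.card ≤ n} → 𝕜) →ₗ[𝕜]
      ((Fin k → Fin n) → 𝕜) →ₗ[𝕜] ((Fin l → Fin n) → 𝕜) :=
  (Matrix.toLin' (R := 𝕜)).toLinearMap ∘ₗ
    { toFun := fun c => Matrix.of fun j i => c (fiberPartition (Fin.append i j))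
      map_add' := fun _ _ => rfl
      map_smul' := fun _ _ => rfl }

theorem mapOfFiberWeights_apply (𝕜 : Type*) [Field 𝕜] {k l n : ℕ}
    (c : {P : Finpartition (Finset.univ : Finset (Fin (k + l))) // P.parts.card ≤ n} → 𝕜)
    (g : (Fin k → Fin n) → 𝕜) (j : Fin l → Fin n) :
    mapOfFiberWeights 𝕜 k l n c g j =
      ∑ i, c (fiberPartition (Fin.append i j)) * g i := rfl

theorem perm_comp_append {k l n : ℕ} (σ : Equiv.Perm (Fin n)) (i : Fin k → Fin n)
    (j : Fin l → Fin n) : σ ∘ Fin.append i j = Fin.append (σ ∘ i) (σ ∘ j) := by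
  funext a
  refine Fin.addCases (fun a => ?_) (fun a => ?_) a <;> simp

theorem mapOfFiberWeights_delta (𝕜 : Type*) [Field 𝕜] {k l n : ℕ}
    (c : {P : Finpartition (Finset.univ : Finset (Fin (k + l))) // P.parts.card ≤ n} → 𝕜)
    (i : Fin k → Fin n) (j : Fin l → Fin n) :
    mapOfFiberWeights 𝕜 k l n c (delta i) j = c (fiberPartition (Fin.append i j)) := by
  simp [mapOfFiberWeights_apply, delta]

theorem append_surjective {k l n : ℕ} (t : Fin (k + l) → Fin n) :
    ∃ (i : Fin k → Fin n) (j : Fin l → Fin n), Fin.append i j = t :=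
  ⟨_, _, Fin.append_castAdd_natAdd⟩

theorem mapOfFiberWeights_injective (𝕜 : Type*) [Field 𝕜] (k l n : ℕ) :
    Function.Injective (mapOfFiberWeights 𝕜 k l n) := by
  intro c d h
  funext P
  obtain ⟨t, rfl⟩ := fiberPartition_surjective P
  obtain ⟨i, j, rfl⟩ := append_surjective t
  rw [← mapOfFiberWeights_delta 𝕜 c, h, mapOfFiberWeights_delta]

theorem permAct_delta {𝕜 : Type*} [Field 𝕜] {ι : Type*} {n : ℕ} (σ : Equiv.Perm (Fin n))
    (i : ι → Fin n) : permAct σ (delta (𝕜 := 𝕜) i) = delta (σ ∘ i) := by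
  funext j
  simp only [permAct, delta, Equiv.symm_comp_eq]

theorem range_mapOfFiberWeights (𝕜 : Type*) [Field 𝕜] (k l n : ℕ) :
    LinearMap.range (mapOfFiberWeights 𝕜 k l n) =
      equivariantMaps 𝕜 k l (Set.univ : Set (Equiv.Perm (Fin n))) := by
  apply le_antisymm
  · rintro _ ⟨c, rfl⟩ σ - g
    funext j
    simp only [permAct, mapOfFiberWeights_apply]
    refine Fintype.sum_equiv (Equiv.arrowCongr (Equiv.refl _) σ.symm) _ _ fun i => ?_
    have harrow : Equiv.arrowCongr (Equiv.refl (Fin k)) σ.symm i = σ.symm ∘ i := rfl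
    rw [harrow, ← perm_comp_append, fiberPartition_perm_comp]
  · intro T hT
    have hinv (σ : Equiv.Perm (Fin n)) (i : Fin k → Fin n) (j : Fin l → Fin n) :
        T (delta (σ ∘ i)) (σ ∘ j) = T (delta i) j := by
      rw [← permAct_delta, hT σ (Set.mem_univ σ), permAct, ← Function.comp_assoc,
        Equiv.symm_comp_self, Function.id_comp]
    let entry (t : Fin (k + l) → Fin n) : 𝕜 :=
      T (delta (t ∘ Fin.castAdd l)) (t ∘ Fin.natAdd k)
    refine ⟨fun P => entry (fiberPartition_surjective P).choose, ?_⟩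
    refine (Pi.basisFun 𝕜 (Fin k → Fin n)).ext fun i => ?_
    have hbasis : Pi.basisFun 𝕜 (Fin k → Fin n) i = delta i := by
      funext j
      simp [delta, Pi.single_apply]
    funext j
    rw [hbasis, mapOfFiberWeights_delta]
    obtain ⟨σ, hσ⟩ := exists_perm_comp_eq_of_fiberPartition_eq
      (fiberPartition_surjective (fiberPartition (Fin.append i j))).choose_spec
    rw [show T (delta i) j = entry (Fin.append i j) by
      simp only [entry, Function.comp_def, Fin.append_left, Fin.append_right]]
    conv_rhs => rw [← hσ]
    exact (hinv σ _ _).symm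

/-- the dimension of the space of `Perm (Fin n)`-equivariant linear maps
`W_k → W_ℓ` equals the number of set partitions of `Fin (k+ℓ)` with at most `n` blocks. -/
theorem statement16 (𝕜 : Type*) [Field 𝕜] (hchar : ringChar 𝕜 ≠ 2)
    (n k l : ℕ) (hn : 0 < n) :
    Module.finrank 𝕜
        ↥(equivariantMaps 𝕜 k l (Set.univ : Set (Equiv.Perm (Fin n)))) =
      Nat.card {P : Finpartition (Finset.univ : Finset (Fin (k + l))) //
        P.parts.card ≤ n} := by
  rw [← range_mapOfFiberWeights, LinearMap.finrank_range_of_inj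
    (mapOfFiberWeights_injective 𝕜 k l n), Module.finrank_fintype_fun_eq_card,
    Nat.card_eq_fintype_card]
end
end

section
/- The dimension over 𝕜 of the space of linear maps T : W_k → W_ℓ commuting with the Perm (Fin n)-actions equals the Bell number B(k+ℓ) (the total number of set partitions of a set with k + ℓ elements) if and only if k + ℓ ≤ n. -/
open scoped Classical

noncomputable section

open Jellyfish

namespace Jellyfish

/-- Set partitions of a finite type correspond to equivalence relations on it. -/
def finpartitionEquivSetoid (ι : Type*) [Fintype ι] [DecidableEq ι] :
    Finpartition (Finset.univ : Finset ι) ≃ Setoid ι where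
  toFun P := Setoid.ker P.part
  invFun s := Finpartition.ofSetoid s
  left_inv P := by
    ext B
    have hpart (a : ι) [DecidablePred (Setoid.ker P.part a)] :
        ({b | Setoid.ker P.part a b} : Finset ι) = P.part a := by
      ext b
      simp [Setoid.ker_def, P.mem_part_iff_part_eq_part (Finset.mem_univ b) (Finset.mem_univ a),
        eq_comm]
    simp only [Finpartition.ofSetoid, Finpartition.ofSetSetoid_parts, Finset.mem_image,
      Finset.mem_univ, true_and]
    constructor
    · rintro ⟨a, rfl⟩
      exact (hpart a).symm ▸ P.part_mem.2 (Finset.mem_univ a)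
    · intro hB
      obtain ⟨a, -, ha⟩ := P.part_surjOn hB
      exact ⟨a, (hpart a).trans ha⟩
  right_inv s := by
    ext a b
    rw [← Finpartition.mem_part_ofSetoid_iff_rel (s := s), Setoid.ker_def,
      Finpartition.mem_part_iff_part_eq_part _ (Finset.mem_univ b) (Finset.mem_univ a), eq_comm]

theorem exists_perm_comp_eq_of_ker_eq {ι α : Type*} [Finite α] {f g : ι → α}
    (h : Setoid.ker f = Setoid.ker g) : ∃ σ : Equiv.Perm α, ⇑σ ∘ f = g := by
  let e : Set.range f ≃ Set.range g :=
    (Setoid.quotientKerEquivRange f).symm.trans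
      ((Quotient.congrRight fun a b => by rw [h]).trans (Setoid.quotientKerEquivRange g))
  refine ⟨Equiv.extendSubtype (p := (· ∈ Set.range f)) (q := (· ∈ Set.range g)) e, ?_⟩
  ext x
  have hx : (Setoid.quotientKerEquivRange f).symm ⟨f x, x, rfl⟩ = Quotient.mk _ x := by
    rw [Equiv.symm_apply_eq]
    rfl
  rw [Function.comp_apply, Equiv.extendSubtype_apply_of_mem _ _ ⟨x, rfl⟩]
  simp only [e, Equiv.trans_apply, hx]
  rfl

theorem ker_perm_comp {ι α : Type*} (σ : Equiv.Perm α) (f : ι → α) :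
    Setoid.ker (⇑σ ∘ f) = Setoid.ker f := by
  ext a b
  simp [Setoid.ker_def]

theorem surjective_ker_iff_card_le (ι α : Type*) [Fintype ι] [Fintype α] [Nonempty α] :
    Function.Surjective (Setoid.ker : (ι → α) → Setoid ι) ↔ Fintype.card ι ≤ Fintype.card α := by
  constructor
  · intro h
    obtain ⟨f, hf⟩ := h ⊥
    exact Fintype.card_le_of_injective f (Setoid.injective_iff_ker_bot f |>.2 hf)
  · intro h s
    obtain ⟨e⟩ := Function.Embedding.nonempty_of_card_le h
    refine ⟨e ∘ fun a => (Quotient.mk s a).out, ?_⟩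
    ext a b
    simp [Setoid.ker_def, Quotient.out_inj, Quotient.eq]

theorem card_range_eq_card_iff_surjective {α β : Type*} [Finite β] (f : α → β) :
    Nat.card (Set.range f) = Nat.card β ↔ Function.Surjective f := by
  rw [Nat.card_coe_set_eq, ← Set.ncard_univ, ← Set.range_eq_univ]
  exact ⟨fun h => Set.eq_of_subset_of_ncard_le (Set.subset_univ _) h.ge, fun h => by rw [h]⟩

/-- The matrix coefficients of a linear map `W_k → W_l`, as a function on tuples of
length `k + l`. -/
def coeffEquiv (𝕜 : Type*) [Field 𝕜] (k l n : ℕ) :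
    (((Fin k → Fin n) → 𝕜) →ₗ[𝕜] ((Fin l → Fin n) → 𝕜)) ≃ₗ[𝕜] ((Fin (k + l) → Fin n) → 𝕜) :=
  LinearMap.toMatrix'.trans <|
    (LinearEquiv.curry 𝕜 𝕜 (Fin l → Fin n) (Fin k → Fin n)).symm.trans <|
    LinearEquiv.funCongrLeft 𝕜 𝕜 ((Fin.appendEquiv k l).symm.trans (Equiv.prodComm _ _))

theorem coeffEquiv_apply {𝕜 : Type*} [Field 𝕜] {k l n : ℕ}
    (T : ((Fin k → Fin n) → 𝕜) →ₗ[𝕜] ((Fin l → Fin n) → 𝕜)) (x : Fin (k + l) → Fin n) :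
    coeffEquiv 𝕜 k l n T x = T (Pi.single (x ∘ Fin.castAdd l) 1) (x ∘ Fin.natAdd k) :=
  LinearMap.toMatrix'_apply T (x ∘ Fin.natAdd k) (x ∘ Fin.castAdd l)

theorem permAct_single {𝕜 : Type*} [Field 𝕜] {ι : Type*} {n : ℕ}
    [DecidableEq (ι → Fin n)] (σ : Equiv.Perm (Fin n)) (i : ι → Fin n) :
    permAct σ (Pi.single i (1 : 𝕜)) = Pi.single (⇑σ ∘ i) 1 := by
  ext j
  simp only [permAct, Pi.single_apply, Equiv.symm_comp_eq]

/-- `permAct` as a linear map. -/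
def permActLinear (𝕜 : Type*) [Field 𝕜] (ι : Type*) {n : ℕ} (σ : Equiv.Perm (Fin n)) :
    ((ι → Fin n) → 𝕜) →ₗ[𝕜] ((ι → Fin n) → 𝕜) :=
  LinearMap.funLeft 𝕜 𝕜 (⇑σ.symm ∘ ·)

theorem mem_equivariantMaps_univ_iff {𝕜 : Type*} [Field 𝕜] {k l n : ℕ}
    (T : ((Fin k → Fin n) → 𝕜) →ₗ[𝕜] ((Fin l → Fin n) → 𝕜)) :
    T ∈ equivariantMaps 𝕜 k l (Set.univ : Set (Equiv.Perm (Fin n))) ↔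
      ∀ (σ : Equiv.Perm (Fin n)) (x : Fin (k + l) → Fin n),
        coeffEquiv 𝕜 k l n T (⇑σ ∘ x) = coeffEquiv 𝕜 k l n T x := by
  constructor
  · intro hT σ x
    have h := congrFun (hT σ (Set.mem_univ σ) (Pi.single (x ∘ Fin.castAdd l) 1))
      (⇑σ ∘ x ∘ Fin.natAdd k)
    rw [permAct_single] at h
    simpa [coeffEquiv_apply, permAct, Function.comp_def] using h
  · intro h σ _ g
    suffices T ∘ₗ permActLinear 𝕜 (Fin k) σ = permActLinear 𝕜 (Fin l) σ ∘ₗ T from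
      LinearMap.congr_fun this g
    apply LinearMap.pi_ext'
    intro i
    ext j
    have hij := h σ (Fin.append i (⇑σ.symm ∘ j))
    rw [coeffEquiv_apply, coeffEquiv_apply] at hij
    change T (permAct σ (Pi.single i 1)) j = T (Pi.single i 1) (⇑σ.symm ∘ j)
    rw [permAct_single]
    simpa [Function.comp_def] using hij

theorem finrank_equivariantMaps_univ (𝕜 : Type*) [Field 𝕜] (k l n : ℕ) :
    Module.finrank 𝕜 ↥(equivariantMaps 𝕜 k l (Set.univ : Set (Equiv.Perm (Fin n)))) =
      Nat.card (Set.range (Setoid.ker : (Fin (k + l) → Fin n) → Setoid (Fin (k + l)))) := by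
  let K := Set.rangeFactorization (Setoid.ker : (Fin (k + l) → Fin n) → Setoid (Fin (k + l)))
  have hK : Function.Surjective K := Set.rangeFactorization_surjective
  have hmap : (equivariantMaps 𝕜 k l Set.univ).map
      (coeffEquiv 𝕜 k l n :
        (((Fin k → Fin n) → 𝕜) →ₗ[𝕜] ((Fin l → Fin n) → 𝕜)) →ₗ[𝕜] ((Fin (k + l) → Fin n) → 𝕜)) =
      LinearMap.range (LinearMap.funLeft 𝕜 𝕜 K) := by
    ext a
    obtain ⟨T, rfl⟩ := (coeffEquiv 𝕜 k l n).surjective a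
    rw [Submodule.mem_map_equiv, LinearEquiv.symm_apply_apply, mem_equivariantMaps_univ_iff]
    constructor
    · intro h
      refine ⟨fun s => coeffEquiv 𝕜 k l n T (Function.surjInv hK s), ?_⟩
      ext x
      obtain ⟨σ, hσ⟩ := exists_perm_comp_eq_of_ker_eq
        (congrArg Subtype.val (Function.surjInv_eq hK (K x)))
      rw [LinearMap.funLeft_apply, ← h σ, hσ]
    · rintro ⟨b, hb⟩ σ x
      rw [← hb, LinearMap.funLeft_apply, LinearMap.funLeft_apply]
      exact congrArg b (Subtype.ext (ker_perm_comp σ x))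
  rw [← LinearEquiv.finrank_map_eq (coeffEquiv 𝕜 k l n), hmap,
    LinearMap.finrank_range_of_inj (LinearMap.funLeft_injective_of_surjective 𝕜 𝕜 K hK),
    Module.finrank_fintype_fun_eq_card, Nat.card_eq_fintype_card]

end Jellyfish

/-- the dimension of the space of `Perm (Fin n)`-equivariant linear maps
`W_k → W_ℓ` equals the Bell number `B(k+ℓ)` iff `k + ℓ ≤ n`. -/
theorem statement17 (𝕜 : Type*) [Field 𝕜] (hchar : ringChar 𝕜 ≠ 2)
    (n k l : ℕ) (hn : 0 < n) :
    (Module.finrank 𝕜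
        ↥(equivariantMaps 𝕜 k l (Set.univ : Set (Equiv.Perm (Fin n)))) =
      Nat.card (Finpartition (Finset.univ : Finset (Fin (k + l))))) ↔
      k + l ≤ n := by
  have : Nonempty (Fin n) := ⟨⟨0, hn⟩⟩
  have := Finite.of_equiv _ (finpartitionEquivSetoid (Fin (k + l)))
  rw [finrank_equivariantMaps_univ, Nat.card_congr (finpartitionEquivSetoid (Fin (k + l))),
    card_range_eq_card_iff_surjective, surjective_ker_iff_card_le, Fintype.card_fin,
    Fintype.card_fin]
end
end
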